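/- Let n be a positive integer and let w be any win condition with w ∈ [1/2,1). Then the w-power index process on the graph G_{3,n}, started from the initial configuration C_0 that assigns strategy D (defector) to every vertex of the clique K_3 and strategy C (collaborator) to every other vertex, is defector dominant. -/

import Mathlib

open scoped Classical

/-- A strategy of a voter: collaborator (`C`) or defector (`D`). -/
inductive Strategy : Type
  | C : Strategy
  | D : Strategy
deriving DecidableEq

noncomputable section

variable {V : Type*}

/-- The closed neighbourhood `N[v]` of a vertex, as a finset. -/
def closedNbhd (G : SimpleGraph V) [Fintype V] (v : V) : Finset V :=
  Finset.univ.filter fun u => u = v ∨ G.Adj u v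

/-- The (Shapley–Shubik style) power of a vertex `v` in configuration `c`
with win condition `w`. -/
def power (G : SimpleGraph V) [Fintype V] (w : ℝ) (c : V → Strategy) (v : V) : ℝ :=
  let N := closedNbhd G v
  let nC := (N.filter fun u => c u = Strategy.C).card
  let nD := (N.filter fun u => c u = Strategy.D).card
  match c v with
  | Strategy.C => if w < (nC : ℝ) / (N.card : ℝ) then 1 / (nC : ℝ) else 0
  | Strategy.D => if (nC : ℝ) / (N.card : ℝ) ≤ w then 1 / (nD : ℝ) else 0

/-- One step of the `w`-power index process: every vertex adopts the strategy of a
vertex of maximum power in its closed neighbourhood, retaining its own strategy if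
vertices of maximum power have differing strategies. -/
def step (G : SimpleGraph V) [Fintype V] (w : ℝ) (c : V → Strategy) (v : V) : Strategy :=
  let N := closedNbhd G v
  let M := N.filter fun u => ∀ x ∈ N, power G w c x ≤ power G w c u
  if ∀ u ∈ M, c u = Strategy.C then Strategy.C
  else if ∀ u ∈ M, c u = Strategy.D then Strategy.D
  else c v

/-- `configSeq G w c0 i` is the configuration `C_i` of the `w`-power index process. -/
def configSeq (G : SimpleGraph V) [Fintype V] (w : ℝ) (c0 : V → Strategy) : ℕ → V → Strategy
  | 0 => c0
  | k + 1 => step G w (configSeq G w c0 k)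

/-- The process is eventually stable. -/
def EventuallyStable (G : SimpleGraph V) [Fintype V] (w : ℝ) (c0 : V → Strategy) : Prop :=
  ∃ i, configSeq G w c0 (i + 1) = configSeq G w c0 i

/-- The process reaches a stable all-collaborator configuration. -/
def CollaboratorDominant (G : SimpleGraph V) [Fintype V] (w : ℝ) (c0 : V → Strategy) : Prop :=
  ∃ i, configSeq G w c0 (i + 1) = configSeq G w c0 i ∧
    ∀ v, configSeq G w c0 i v = Strategy.C

/-- The process reaches a stable all-defector configuration. -/
def DefectorDominant (G : SimpleGraph V) [Fintype V] (w : ℝ) (c0 : V → Strategy) : Prop :=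
  ∃ i, configSeq G w c0 (i + 1) = configSeq G w c0 i ∧
    ∀ v, configSeq G w c0 i v = Strategy.D

/-- The process is eventually periodic with period `ℓ`: `ℓ > 1` is the least integer
such that `C_i = C_{i+ℓ}` for some `i ≥ 0`. -/
def EventuallyPeriodicWithPeriod (G : SimpleGraph V) [Fintype V] (w : ℝ)
    (c0 : V → Strategy) (ℓ : ℕ) : Prop :=
  IsLeast {m : ℕ | 1 < m ∧ ∃ i, configSeq G w c0 (i + m) = configSeq G w c0 i} ℓ

end

/-- `IsGjn G j n` witnesses that `G` is a graph of the form `G_{j,n}`: a disjoint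
union of cliques of sizes `j, 2j, 4j, …, j·2^n` (block `i` has size `j·2^i`), with
edges only inside blocks and between successive blocks, such that every vertex of
block `i < n` has exactly two neighbours in block `i+1` and every vertex of block
`i ≥ 1` has exactly one neighbour in block `i-1`. -/
structure IsGjn {V : Type*} [Fintype V] (G : SimpleGraph V) (j n : ℕ) : Type _ where
  blk : V → ℕ
  blk_le : ∀ v, blk v ≤ n
  card_blk : ∀ i ≤ n, (Finset.univ.filter fun v => blk v = i).card = j * 2 ^ i
  adj_within : ∀ u v : V, u ≠ v → blk u = blk v → G.Adj u v
  adj_between : ∀ u v : V, G.Adj u v →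
    blk u = blk v ∨ blk u + 1 = blk v ∨ blk v + 1 = blk u
  up_two : ∀ v : V, blk v < n →
    (Finset.univ.filter fun u => G.Adj v u ∧ blk u = blk v + 1).card = 2
  down_one : ∀ v : V, 1 ≤ blk v →
    (Finset.univ.filter fun u => G.Adj v u ∧ blk u + 1 = blk v).card = 1

theorem step_eq_C {V : Type} [Fintype V] (G : SimpleGraph V) (w : ℝ) (c : V → Strategy) (v : V)
    (hC : ∀ u ∈ closedNbhd G v, c u = Strategy.C) : step G w c v = Strategy.C := by
  unfold step
  rw [if_pos]
  intro u hu
  exact hC u (Finset.mem_filter.1 hu).1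

theorem step_eq_D {V : Type} [Fintype V] (G : SimpleGraph V) (w : ℝ) (c : V → Strategy) (v u : V)
    (hu : u ∈ closedNbhd G v)
    (hC : ∀ x ∈ closedNbhd G v, c x = Strategy.C → power G w c x < power G w c u) :
    step G w c v = Strategy.D := by
  have hD : ∀ x ∈ (closedNbhd G v).filter
      (fun u => ∀ x ∈ closedNbhd G v, power G w c x ≤ power G w c u), c x = Strategy.D := by
    intro x hx
    rw [Finset.mem_filter] at hx
    cases hcx : c x with
    | D => rfl
    | C => exact absurd (hx.2 u hu) (not_le.2 (hC x hx.1 hcx))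
  unfold step
  rw [if_neg, if_pos]
  · exact hD
  · intro hall
    obtain ⟨m, hm, hmax⟩ := (closedNbhd G v).exists_max_image (power G w c) ⟨u, hu⟩
    have hmM : m ∈ (closedNbhd G v).filter
        (fun u => ∀ x ∈ closedNbhd G v, power G w c x ≤ power G w c u) :=
      Finset.mem_filter.2 ⟨hm, hmax⟩
    have h1 := hD m hmM
    have h2 := hall m hmM
    rw [h1] at h2
    cases h2

/-- The configuration in which exactly the blocks `≤ k` defect. -/
noncomputable def cfg {V : Type} (b : V → ℕ) (k : ℕ) (v : V) : Strategy :=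
  if b v ≤ k then Strategy.D else Strategy.C

theorem cfg_C {V : Type} (b : V → ℕ) (k : ℕ) (v : V) : cfg b k v = Strategy.C ↔ k < b v := by
  unfold cfg
  split_ifs with hh
  · simp [hh]
  · simpa using hh

theorem cfg_D {V : Type} (b : V → ℕ) (k : ℕ) (v : V) : cfg b k v = Strategy.D ↔ b v ≤ k := by
  unfold cfg
  split_ifs with hh
  · simp [hh]
  · simpa using hh

theorem power_C_le {V : Type} [Fintype V] (G : SimpleGraph V) (n : ℕ) (h : IsGjn G 3 n) (w : ℝ)
    (k : ℕ) (x : V) (hx : k < h.blk x) :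
    power G w (cfg h.blk k) x ≤ 1 / (3 * 2 ^ (k + 1) : ℕ) := by
  have hc : cfg h.blk k x = Strategy.C := (cfg_C _ _ _).2 hx
  unfold power
  simp only [hc]
  split_ifs
  · have hle : 3 * 2 ^ (k + 1) ≤
        ((closedNbhd G x).filter fun u => cfg h.blk k u = Strategy.C).card := by
      calc 3 * 2 ^ (k + 1) ≤ 3 * 2 ^ (h.blk x) :=
            Nat.mul_le_mul_left _ (Nat.pow_le_pow_right (by norm_num) hx)
        _ = _ := (h.card_blk _ (h.blk_le x)).symm
        _ ≤ _ := by
          apply Finset.card_le_card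
          intro u hu
          have hb := (Finset.mem_filter.1 hu).2
          rw [Finset.mem_filter, cfg_C]
          refine ⟨?_, by omega⟩
          unfold closedNbhd
          simp only [Finset.mem_filter, Finset.mem_univ, true_and]
          by_cases e : u = x
          · exact Or.inl e
          · exact Or.inr (h.adj_within u x e hb)
    apply one_div_le_one_div_of_le
    · exact_mod_cast (by positivity : 0 < 3 * 2 ^ (k + 1))
    · exact_mod_cast hle
  · positivity

theorem power_D_ge {V : Type} [Fintype V] (G : SimpleGraph V) (n : ℕ) (h : IsGjn G 3 n) (w : ℝ)
    (hw1 : 1 / 2 ≤ w) (k : ℕ) (hk : k < n) (x : V) (hx : h.blk x = k) :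
    1 / (3 * 2 ^ k + 1 : ℕ) ≤ power G w (cfg h.blk k) x := by
  have hc : cfg h.blk k x = Strategy.D := (cfg_D _ _ _).2 hx.le
  have hpos : 1 ≤ 2 ^ k := Nat.one_le_two_pow
  have hC : ((closedNbhd G x).filter fun u => cfg h.blk k u = Strategy.C).card ≤ 2 := by
    rw [← h.up_two x (by omega)]
    apply Finset.card_le_card
    intro u hu
    rw [Finset.mem_filter, cfg_C] at hu
    obtain ⟨h1, h2⟩ := hu
    unfold closedNbhd at h1
    simp only [Finset.mem_filter, Finset.mem_univ, true_and] at h1 ⊢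
    rcases h1 with rfl | h1
    · omega
    · have := h.adj_between _ _ h1
      exact ⟨h1.symm, by omega⟩
  have hD1 : 3 * 2 ^ k ≤
      ((closedNbhd G x).filter fun u => cfg h.blk k u = Strategy.D).card := by
    rw [← h.card_blk k hk.le]
    apply Finset.card_le_card
    intro u hu
    have hb := (Finset.mem_filter.1 hu).2
    rw [Finset.mem_filter, cfg_D]
    refine ⟨?_, by omega⟩
    unfold closedNbhd
    simp only [Finset.mem_filter, Finset.mem_univ, true_and]
    by_cases e : u = x
    · exact Or.inl e
    · exact Or.inr (h.adj_within u x e (by omega))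
  have hdown : (Finset.univ.filter fun u => G.Adj x u ∧ h.blk u + 1 = h.blk x).card ≤ 1 := by
    by_cases h0 : 1 ≤ h.blk x
    · exact (h.down_one x h0).le
    · rw [Finset.filter_false_of_mem]
      · simp
      · intro u _ hu
        omega
  have hD2 : ((closedNbhd G x).filter fun u => cfg h.blk k u = Strategy.D).card
      ≤ 3 * 2 ^ k + 1 := by
    calc _ ≤ ((Finset.univ.filter fun v => h.blk v = k) ∪
          (Finset.univ.filter fun u => G.Adj x u ∧ h.blk u + 1 = h.blk x)).card := by
          apply Finset.card_le_card
          intro u hu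
          rw [Finset.mem_filter, cfg_D] at hu
          obtain ⟨h1, h2⟩ := hu
          unfold closedNbhd at h1
          simp only [Finset.mem_filter, Finset.mem_univ, true_and, Finset.mem_union] at h1 ⊢
          rcases h1 with rfl | h1
          · exact Or.inl hx
          · have := h.adj_between _ _ h1
            by_cases e : h.blk u = k
            · exact Or.inl e
            · exact Or.inr ⟨h1.symm, by omega⟩
      _ ≤ _ := Finset.card_union_le _ _
      _ ≤ _ := by
        rw [h.card_blk k hk.le]
        omega
  have hsum : ((closedNbhd G x).filter fun u => cfg h.blk k u = Strategy.C).card +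
      ((closedNbhd G x).filter fun u => cfg h.blk k u = Strategy.D).card
      ≤ (closedNbhd G x).card := by
    rw [← Finset.card_union_of_disjoint]
    · apply Finset.card_le_card
      intro u hu
      simp only [Finset.mem_union, Finset.mem_filter] at hu
      tauto
    · rw [Finset.disjoint_filter]
      intro u _ h1 h2
      rw [h1] at h2
      cases h2
  unfold power
  simp only [hc]
  rw [if_pos]
  · apply one_div_le_one_div_of_le
    · exact_mod_cast (by omega)
    · exact_mod_cast hD2
  · refine le_trans ?_ hw1
    have hN : (0 : ℝ) < (closedNbhd G x).card := by exact_mod_cast (by omega)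
    rw [div_le_iff₀ hN]
    have h2 : 2 * ((closedNbhd G x).filter fun u => cfg h.blk k u = Strategy.C).card
      ≤ (closedNbhd G x).card := by omega
    have h3 : (2 : ℝ) * ((closedNbhd G x).filter fun u => cfg h.blk k u = Strategy.C).card
      ≤ (closedNbhd G x).card := by exact_mod_cast h2
    linarith

theorem power_lt {V : Type} [Fintype V] (G : SimpleGraph V) (n : ℕ) (h : IsGjn G 3 n) (w : ℝ)
    (hw1 : 1 / 2 ≤ w) (k : ℕ) (hk : k < n) (x u : V) (hx : k < h.blk x) (hu : h.blk u = k) :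
    power G w (cfg h.blk k) x < power G w (cfg h.blk k) u := by
  refine (power_C_le G n h w k x hx).trans_lt
    (lt_of_lt_of_le ?_ (power_D_ge G n h w hw1 k hk u hu))
  have hpos : 1 ≤ 2 ^ k := Nat.one_le_two_pow
  apply one_div_lt_one_div_of_lt
  · exact_mod_cast Nat.succ_pos _
  · have : 3 * 2 ^ k + 1 < 3 * 2 ^ (k + 1) := by
      rw [pow_succ]
      omega
    exact_mod_cast this

theorem mem_closedNbhd {V : Type} [Fintype V] (G : SimpleGraph V) (u v : V) :
    u ∈ closedNbhd G v ↔ u = v ∨ G.Adj u v := by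
  simp [closedNbhd]

theorem step_cfg {V : Type} [Fintype V] (G : SimpleGraph V) (n : ℕ) (h : IsGjn G 3 n) (w : ℝ)
    (hw1 : 1 / 2 ≤ w) (k : ℕ) (hk : k < n) :
    step G w (cfg h.blk k) = cfg h.blk (k + 1) := by
  funext v
  rcases lt_or_ge (k + 1) (h.blk v) with h1 | h1
  · rw [(cfg_C _ _ _).2 h1]
    apply step_eq_C
    intro u hu
    rw [cfg_C]
    rcases (mem_closedNbhd G u v).1 hu with rfl | hu
    · omega
    · have := h.adj_between _ _ hu
      omega
  · rw [(cfg_D _ _ _).2 h1]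
    rcases Nat.lt_or_ge (h.blk v) k with h2 | h2
    · apply step_eq_D G w _ v v ((mem_closedNbhd G v v).2 (Or.inl rfl))
      intro x hx hxC
      rw [cfg_C] at hxC
      exfalso
      rcases (mem_closedNbhd G x v).1 hx with rfl | hx
      · omega
      · have := h.adj_between _ _ hx
        omega
    · rcases h2.eq_or_lt with h3 | h3
      · apply step_eq_D G w _ v v ((mem_closedNbhd G v v).2 (Or.inl rfl))
        intro x hx hxC
        rw [cfg_C] at hxC
        exact power_lt G n h w hw1 k hk x v hxC h3.symm
      · have hd := h.down_one v (by omega)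
        obtain ⟨u, hu⟩ := Finset.card_pos.1 (by rw [hd]; exact one_pos)
        have hu2 := (Finset.mem_filter.1 hu).2
        apply step_eq_D G w _ v u ((mem_closedNbhd G u v).2 (Or.inr hu2.1.symm))
        intro x hx hxC
        rw [cfg_C] at hxC
        exact power_lt G n h w hw1 k hk x u hxC (by omega)

/-- For any positive integer `n` and any win condition
`w ∈ [1/2, 1)`, the `w`-power index process on `G_{3,n}`, started from the
configuration assigning `D` to the vertices of `K_3` (block `0`) and `C` to all
other vertices, is defector dominant. -/
theorem statement1 {V : Type} [Fintype V] (G : SimpleGraph V) (n : ℕ)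
    (hn : 0 < n) (h : IsGjn G 3 n) (w : ℝ)
    (hw1 : 1 / 2 ≤ w) (hw2 : w < 1) :
    DefectorDominant G w
      (fun v => if h.blk v = 0 then Strategy.D else Strategy.C) := by
  have h0 : (fun v => if h.blk v = 0 then Strategy.D else Strategy.C) = cfg h.blk 0 := by
    funext v
    simp [cfg]
  rw [h0]
  have key : ∀ k, k ≤ n → configSeq G w (cfg h.blk 0) k = cfg h.blk k := by
    intro k
    induction k with
    | zero => intro _; rfl
    | succ k ih =>
      intro hk
      change step G w (configSeq G w (cfg h.blk 0) k) = _
      rw [ih (by omega)]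
      exact step_cfg G n h w hw1 k hk
  have hall : ∀ v, cfg h.blk n v = Strategy.D := fun v => (cfg_D _ _ _).2 (h.blk_le v)
  refine ⟨n, ?_, ?_⟩
  · change step G w (configSeq G w (cfg h.blk 0) n) = _
    rw [key n le_rfl]
    funext v
    rw [hall v]
    apply step_eq_D G w _ v v ((mem_closedNbhd G v v).2 (Or.inl rfl))
    intro x _ hxC
    rw [hall x] at hxC
    cases hxC
  · rw [key n le_rfl]
    exact hall
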